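/- arXiv:2006.15412 — 11 statements merged into one kernel-verified Lean document; each statement's English description precedes it below -/
import Mathlib

section
/- Let f be a submodular set function on a finite ground set Ω. Then the following are equivalent: (i) for every fixed B ⊆ Ω, the function A ↦ I_f(A;B) is submodular in A; (ii) the second-order partial derivatives are monotone non-decreasing, i.e., f^{(2)}(j,k;A) ≤ f^{(2)}(j,k;A') whenever A ⊆ A' and j, k ∉ A' are distinct (equivalently, all third-order partial derivatives f^{(3)}(i,j,k;A) = f^{(2)}(j,k;A∪{i}) − f^{(2)}(j,k;A) are non-negative). -/
/-- The submodularity defect of `f` when `P` and `Q` are added to the base set `C`. -/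
def submodularityDefect {Ω : Type*} [DecidableEq Ω] (f : Finset Ω → ℝ) (C P Q : Finset Ω) : ℝ :=
  f (C ∪ P) + f (C ∪ Q) - f (C ∪ P ∪ Q) - f C

namespace submodularityDefect

variable {Ω : Type*} [DecidableEq Ω] (f : Finset Ω → ℝ)

lemma comm (C P Q : Finset Ω) :
    submodularityDefect f C P Q = submodularityDefect f C Q P := by
  simp only [submodularityDefect, Finset.union_right_comm C P Q]
  ring

lemma union_left (C P P' Q : Finset Ω) :
    submodularityDefect f C (P ∪ P') Q =
      submodularityDefect f C P Q + submodularityDefect f (C ∪ P) P' Q := by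
  simp only [submodularityDefect, ← Finset.union_assoc]
  ring

@[simp]
lemma empty_left (C Q : Finset Ω) : submodularityDefect f C ∅ Q = 0 := by
  simp [submodularityDefect]

lemma eq_zero_of_subset {C P : Finset Ω} (h : P ⊆ C) (Q : Finset Ω) :
    submodularityDefect f C P Q = 0 := by
  simp [submodularityDefect, Finset.union_eq_left.mpr h]

variable {f}

lemma nonneg (hf : ∀ X Y : Finset Ω, f (X ∪ Y) + f (X ∩ Y) ≤ f X + f Y)
    (C : Finset Ω) {P Q : Finset Ω} (h : Disjoint P Q) :
    0 ≤ submodularityDefect f C P Q := by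
  have key := hf (C ∪ P) (C ∪ Q)
  rw [← Finset.union_inter_distrib_left, Finset.disjoint_iff_inter_eq_empty.mp h,
    Finset.union_empty, ← Finset.union_union_distrib_left, ← Finset.union_assoc] at key
  unfold submodularityDefect
  linarith

/-- Antitonicity in the base set extends from single elements on the left to finite sets. -/
lemma antitone_of_singleton_left {Q : Finset Ω} (P : Finset Ω)
    (h : ∀ i ∈ P, Antitone fun C => submodularityDefect f C {i} Q) :
    Antitone fun C => submodularityDefect f C P Q := by
  induction P using Finset.induction_on with
  | empty => simpa using antitone_const
  | insert i P _ ih =>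
    intro C C' hC
    have h₁ := ih (fun j hj => h j (Finset.mem_insert_of_mem hj)) hC
    have h₂ := h i (Finset.mem_insert_self i P) (Finset.union_subset_union_left (t := P) hC)
    rw [Finset.insert_eq, Finset.union_comm]
    simp only [union_left] at h₁ h₂ ⊢
    exact add_le_add h₁ h₂

lemma antitone_of_singletons {P Q : Finset Ω}
    (h : ∀ j ∈ P, ∀ k ∈ Q, Antitone fun C => submodularityDefect f C {j} {k}) :
    Antitone fun C => submodularityDefect f C P Q := by
  refine antitone_of_singleton_left P fun j hj => ?_
  simp only [comm f _ {j} Q]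
  refine antitone_of_singleton_left Q fun k hk => ?_
  simpa only [comm f _ {k} {j}] using h j hj k hk

end submodularityDefect


/-- For a submodular `f`, the following are equivalent:
(i) for every fixed `B`, `A ↦ I_f(A;B)` is submodular in `A`;
(ii) the second-order partial derivatives
`f⁽²⁾(j,k;A) = f(A∪{j,k}) − f(A∪{j}) − f(A∪{k}) + f(A)` are monotone non-decreasing in `A`
(for distinct `j, k` outside the sets), equivalently all third-order partial derivatives
are non-negative. -/
theorem mutual_information_submodular_iff_second_order_supermodular
    {Ω : Type*} [DecidableEq Ω] [Fintype Ω] (f : Finset Ω → ℝ)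
    (hsubmod : ∀ X Y : Finset Ω, f (X ∪ Y) + f (X ∩ Y) ≤ f X + f Y) :
    (∀ B X Y : Finset Ω,
      (f (X ∪ Y) + f B - f ((X ∪ Y) ∪ B)) + (f (X ∩ Y) + f B - f ((X ∩ Y) ∪ B))
        ≤ (f X + f B - f (X ∪ B)) + (f Y + f B - f (Y ∪ B)))
    ↔
    (∀ (A A' : Finset Ω) (j k : Ω), A ⊆ A' → j ≠ k → j ∉ A' → k ∉ A' →
      f (A ∪ {j, k}) - f (A ∪ {j}) - f (A ∪ {k}) + f A
        ≤ f (A' ∪ {j, k}) - f (A' ∪ {j}) - f (A' ∪ {k}) + f A') := by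
  constructor
  · intro h A A' j k hA hjk hj hk
    have key := h A' (A ∪ {j}) (A ∪ {k})
    have hdisj : ({j} : Finset Ω) ∩ {k} = ∅ :=
      Finset.disjoint_iff_inter_eq_empty.mp (Finset.disjoint_singleton.mpr hjk)
    have hunion (C : Finset Ω) : C ∪ {j} ∪ (C ∪ {k}) = C ∪ {j, k} := by
      rw [← Finset.union_union_distrib_left, Finset.insert_eq]
    have habsorb (S : Finset Ω) : A ∪ S ∪ A' = A' ∪ S := by
      rw [Finset.union_right_comm, Finset.union_eq_right.mpr hA]
    rw [hunion, ← Finset.union_inter_distrib_left, hdisj] at key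
    simp only [habsorb, Finset.union_empty] at key
    rw [Finset.union_eq_right.mpr hA] at key
    linarith
  · intro h B X Y
    have hpair {j k : Ω} (hjk : j ≠ k) :
        Antitone fun C => submodularityDefect f C {j} {k} := by
      intro C C' hC
      have hnonneg := submodularityDefect.nonneg hsubmod C (Finset.disjoint_singleton.mpr hjk)
      by_cases hj : j ∈ C'
      · simpa [submodularityDefect.eq_zero_of_subset f (Finset.singleton_subset_iff.mpr hj)]
          using hnonneg
      by_cases hk : k ∈ C'
      · simpa [submodularityDefect.comm f C' {j},
          submodularityDefect.eq_zero_of_subset f (Finset.singleton_subset_iff.mpr hk)]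
          using hnonneg
      have key := h C C' j k hC hjk hj hk
      simp only [Finset.insert_eq j {k}, ← Finset.union_assoc] at key
      simp only [submodularityDefect]
      linarith
    have key := submodularityDefect.antitone_of_singletons (f := f) (P := X \ Y) (Q := Y \ X)
      (fun j hj k hk => hpair (by rintro rfl; simp_all))
      (Finset.subset_union_left : X ∩ Y ⊆ X ∩ Y ∪ B)
    have hX : X ∩ Y ∪ X \ Y = X := by grind
    have hY : X ∩ Y ∪ Y \ X = Y := by grind
    have hXY : X ∪ Y \ X = X ∪ Y := by grind
    simp only [submodularityDefect, Finset.union_right_comm _ B, hX, hY, hXY] at key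
    linarith
end

section
/- Let f be a submodular set function on a finite ground set Ω. Then for all A, B ⊆ Ω: f(A) − Σ_{j ∈ A∖B} f({j}|B) ≤ I_f(A;B) ≤ f(A) − Σ_{j ∈ A∖B} f({j}|Ω∖{j}). If moreover f is monotone, then f(A) − Σ_{j ∈ A∖B} f({j}|Ω∖{j}) ≤ f(A). -/
/-- Diminishing returns: the marginal gain of a new element decreases as the set grows. -/
theorem submodular_gain_antitone {Ω : Type*} [DecidableEq Ω] {f : Finset Ω → ℝ}
    (hsubmod : ∀ X Y : Finset Ω, f (X ∪ Y) + f (X ∩ Y) ≤ f X + f Y)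
    {X Y : Finset Ω} (hXY : X ⊆ Y) {j : Ω} (hj : j ∉ Y) :
    f ({j} ∪ Y) - f Y ≤ f ({j} ∪ X) - f X := by
  have h := hsubmod ({j} ∪ X) Y
  have hunion : ({j} ∪ X) ∪ Y = {j} ∪ Y := by
    rw [Finset.union_assoc, Finset.union_eq_right.2 hXY]
  have hinter : ({j} ∪ X) ∩ Y = X := by
    rw [Finset.union_inter_distrib_right, Finset.singleton_inter_of_notMem hj,
      Finset.empty_union, Finset.inter_eq_left.2 hXY]
  rw [hunion, hinter] at h
  linarith

/-- The gain of a set disjoint from `B` is at most the sum of the gains of its elements over `B`. -/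
theorem submodular_gain_le_sum {Ω : Type*} [DecidableEq Ω] {f : Finset Ω → ℝ}
    (hsubmod : ∀ X Y : Finset Ω, f (X ∪ Y) + f (X ∩ Y) ≤ f X + f Y)
    {S B : Finset Ω} (hSB : Disjoint S B) :
    f (S ∪ B) - f B ≤ ∑ j ∈ S, (f ({j} ∪ B) - f B) := by
  induction S using Finset.induction_on with
  | empty => simp
  | insert a S ha ih =>
    obtain ⟨haB, hS⟩ := Finset.disjoint_insert_left.1 hSB
    have h := submodular_gain_antitone hsubmod (X := B) (Y := S ∪ B) (j := a)
      Finset.subset_union_right (by simp [ha, haB])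
    rw [Finset.sum_insert ha, Finset.insert_eq, Finset.union_assoc]
    linarith [ih hS]

/-- The gain of a set disjoint from `B` is at least the sum of the gains of its elements over
their complements. -/
theorem sum_le_submodular_gain {Ω : Type*} [DecidableEq Ω] [Fintype Ω] {f : Finset Ω → ℝ}
    (hsubmod : ∀ X Y : Finset Ω, f (X ∪ Y) + f (X ∩ Y) ≤ f X + f Y)
    {S B : Finset Ω} (hSB : Disjoint S B) :
    ∑ j ∈ S, (f ({j} ∪ (Finset.univ \ {j})) - f (Finset.univ \ {j})) ≤ f (S ∪ B) - f B := by
  induction S using Finset.induction_on with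
  | empty => simp
  | insert a S ha ih =>
    obtain ⟨haB, hS⟩ := Finset.disjoint_insert_left.1 hSB
    have hsub : S ∪ B ⊆ Finset.univ \ {a} :=
      Finset.subset_sdiff.2 ⟨Finset.subset_univ _, by simp [ha, haB]⟩
    have h := submodular_gain_antitone hsubmod hsub (j := a) (by simp)
    rw [Finset.sum_insert ha, Finset.insert_eq, Finset.union_assoc]
    linarith [ih hS]

/-- For a submodular `f`:
`f(A) − Σ_{j ∈ A∖B} f({j}|B) ≤ I_f(A;B) ≤ f(A) − Σ_{j ∈ A∖B} f({j}|Ω∖{j})`,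
and if `f` is moreover monotone, the upper bound is at most `f(A)`. -/
theorem submodular_mutual_information_modular_bounds
    {Ω : Type*} [DecidableEq Ω] [Fintype Ω] (f : Finset Ω → ℝ)
    (hsubmod : ∀ X Y : Finset Ω, f (X ∪ Y) + f (X ∩ Y) ≤ f X + f Y) :
    ∀ A B : Finset Ω,
      (f A - ∑ j ∈ A \ B, (f ({j} ∪ B) - f B) ≤ f A + f B - f (A ∪ B)) ∧
      (f A + f B - f (A ∪ B)
        ≤ f A - ∑ j ∈ A \ B, (f ({j} ∪ (Finset.univ \ {j})) - f (Finset.univ \ {j}))) ∧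
      ((∀ X Y : Finset Ω, X ⊆ Y → f X ≤ f Y) →
        f A - ∑ j ∈ A \ B, (f ({j} ∪ (Finset.univ \ {j})) - f (Finset.univ \ {j})) ≤ f A) := by
  intro A B
  have hle := submodular_gain_le_sum hsubmod (Finset.sdiff_disjoint (s := B) (t := A))
  have hge := sum_le_submodular_gain hsubmod (Finset.sdiff_disjoint (s := B) (t := A))
  rw [Finset.sdiff_union_self_eq_union] at hle hge
  refine ⟨by linarith, by linarith, fun hmono => sub_le_self _ (Finset.sum_nonneg fun j _ => ?_)⟩
  exact sub_nonneg.2 (hmono _ _ Finset.subset_union_right)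
end

section
/- Let f be a monotone submodular set function on a finite ground set Ω. Then for all A, B, C, D ⊆ Ω, I_f(A∪D; B∪D; C∪D) ≥ I_f(A;B;C), where I_f(A;B;C) denotes the 3-set submodular mutual information. -/
/-- Diminishing returns: the gain from adding `D` to `X` is at least the gain from adding `D` to a
superset `Y` of `X`. -/
theorem union_gain_le_of_subset {Ω : Type*} [DecidableEq Ω] (f : Finset Ω → ℝ)
    (hmono : ∀ X Y : Finset Ω, X ⊆ Y → f X ≤ f Y)
    (hsubmod : ∀ X Y : Finset Ω, f (X ∪ Y) + f (X ∩ Y) ≤ f X + f Y)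
    {X Y : Finset Ω} (hXY : X ⊆ Y) (D : Finset Ω) :
    f (Y ∪ D) - f Y ≤ f (X ∪ D) - f X := by
  have hunion : X ∪ D ∪ Y = Y ∪ D := by grind
  have hinter : X ⊆ (X ∪ D) ∩ Y := by grind
  have hsub := hsubmod (X ∪ D) Y
  rw [hunion] at hsub
  linarith [hmono _ _ hinter]

/-- For a monotone submodular `f`, the 3-set submodular mutual information satisfies
`I_f(A∪D; B∪D; C∪D) ≥ I_f(A;B;C)` for all `A, B, C, D`. -/
theorem three_set_mutual_information_monotone_joint
    {Ω : Type*} [DecidableEq Ω] [Fintype Ω] (f : Finset Ω → ℝ)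
    (hmono : ∀ X Y : Finset Ω, X ⊆ Y → f X ≤ f Y)
    (hsubmod : ∀ X Y : Finset Ω, f (X ∪ Y) + f (X ∩ Y) ≤ f X + f Y) :
    ∀ A B C D : Finset Ω,
      f A + f B + f C - f (A ∪ B) - f (B ∪ C) - f (A ∪ C) + f (A ∪ B ∪ C)
        ≤ f (A ∪ D) + f (B ∪ D) + f (C ∪ D)
            - f ((A ∪ D) ∪ (B ∪ D)) - f ((B ∪ D) ∪ (C ∪ D)) - f ((A ∪ D) ∪ (C ∪ D))
            + f ((A ∪ D) ∪ (B ∪ D) ∪ (C ∪ D)) := by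
  intro A B C D
  have gain := @union_gain_le_of_subset Ω _ f hmono hsubmod
  have hAB := gain (X := A) (Y := A ∪ B) Finset.subset_union_left D
  have hBC := gain (X := B) (Y := B ∪ C) Finset.subset_union_left D
  have hAC := gain (X := C) (Y := A ∪ C) Finset.subset_union_right D
  have hABC := hmono (A ∪ B ∪ C) (A ∪ B ∪ C ∪ D) Finset.subset_union_left
  simp only [← Finset.union_union_distrib_right]
  linarith
end

section
/- Let f be a monotone submodular set function on a finite ground set Ω. Then for all A, B, C ⊆ Ω, the 3-set submodular mutual information satisfies I_f(A;B;C) ≤ min(f(A), f(B), f(C)); and for all A, B, C, D ⊆ Ω, the 4-set submodular mutual information satisfies I_f(A;B;C;D) ≤ min(f(A), f(B), f(C), f(D)). -/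
/-- For a monotone submodular `f`, submodularity applied to two unions sharing the set `Y`. -/
theorem add_le_add_of_union_of_union {Ω : Type*} [DecidableEq Ω] (f : Finset Ω → ℝ)
    (hmono : ∀ X Y : Finset Ω, X ⊆ Y → f X ≤ f Y)
    (hsubmod : ∀ X Y : Finset Ω, f (X ∪ Y) + f (X ∩ Y) ≤ f X + f Y) (X Y Z : Finset Ω) :
    f (X ∪ Y ∪ Z) + f Y ≤ f (X ∪ Y) + f (Y ∪ Z) := by
  have h := hsubmod (X ∪ Y) (Y ∪ Z)
  have hunion : X ∪ Y ∪ (Y ∪ Z) = X ∪ Y ∪ Z := by grind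
  have hinter := hmono Y ((X ∪ Y) ∩ (Y ∪ Z)) (by grind)
  rw [hunion] at h
  linarith

/-- The three-set bound by the first argument, with the term `f A` cancelled. -/
theorem three_set_cancelled_le {Ω : Type*} [DecidableEq Ω] (f : Finset Ω → ℝ)
    (hmono : ∀ X Y : Finset Ω, X ⊆ Y → f X ≤ f Y)
    (hsubmod : ∀ X Y : Finset Ω, f (X ∪ Y) + f (X ∩ Y) ≤ f X + f Y) (A B C : Finset Ω) :
    f B + f C + f (A ∪ B ∪ C) ≤ f (A ∪ B) + f (B ∪ C) + f (A ∪ C) := by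
  have h := add_le_add_of_union_of_union f hmono hsubmod A B C
  have hC := hmono C (A ∪ C) Finset.subset_union_right
  linarith

/-- The four-set bound by the first argument, with the term `f A` cancelled. -/
theorem four_set_cancelled_le {Ω : Type*} [DecidableEq Ω] (f : Finset Ω → ℝ)
    (hmono : ∀ X Y : Finset Ω, X ⊆ Y → f X ≤ f Y)
    (hsubmod : ∀ X Y : Finset Ω, f (X ∪ Y) + f (X ∩ Y) ≤ f X + f Y) (A B C D : Finset Ω) :
    f B + f C + f D + f (A ∪ B ∪ C) + f (A ∪ B ∪ D) + f (A ∪ C ∪ D) + f (B ∪ C ∪ D)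
      ≤ f (A ∪ B) + f (A ∪ C) + f (A ∪ D) + f (B ∪ C) + f (B ∪ D) + f (C ∪ D)
        + f (A ∪ B ∪ C ∪ D) := by
  have hB := add_le_add_of_union_of_union f hmono hsubmod A B C
  have hC := add_le_add_of_union_of_union f hmono hsubmod A C D
  have hD := add_le_add_of_union_of_union f hmono hsubmod A D B
  rw [Finset.union_right_comm A D B, Finset.union_comm D B] at hD
  have hmonoBCD := hmono (B ∪ C ∪ D) (A ∪ B ∪ C ∪ D) (by grind)
  linarith


/-- For a monotone submodular `f`, the 3-set submodular mutual information is at most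
`min(f(A), f(B), f(C))`, and the 4-set submodular mutual information is at most
`min(f(A), f(B), f(C), f(D))`. -/
theorem multi_set_mutual_information_upper_bound_three_and_four
    {Ω : Type*} [DecidableEq Ω] [Fintype Ω] (f : Finset Ω → ℝ)
    (hmono : ∀ X Y : Finset Ω, X ⊆ Y → f X ≤ f Y)
    (hsubmod : ∀ X Y : Finset Ω, f (X ∪ Y) + f (X ∩ Y) ≤ f X + f Y) :
    (∀ A B C : Finset Ω,
      f A + f B + f C - f (A ∪ B) - f (B ∪ C) - f (A ∪ C) + f (A ∪ B ∪ C)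
        ≤ min (f A) (min (f B) (f C))) ∧
    (∀ A B C D : Finset Ω,
      f A + f B + f C + f D
        - f (A ∪ B) - f (A ∪ C) - f (A ∪ D) - f (B ∪ C) - f (B ∪ D) - f (C ∪ D)
        + f (A ∪ B ∪ C) + f (A ∪ B ∪ D) + f (A ∪ C ∪ D) + f (B ∪ C ∪ D)
        - f (A ∪ B ∪ C ∪ D)
        ≤ min (f A) (min (f B) (min (f C) (f D)))) := by
  refine ⟨fun A B C => ?_, fun A B C D => ?_⟩
  · have hA := three_set_cancelled_le f hmono hsubmod A B C
    have hB := three_set_cancelled_le f hmono hsubmod B A C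
    have hC := three_set_cancelled_le f hmono hsubmod C A B
    simp only [Finset.union_comm, Finset.union_left_comm, le_min_iff] at *
    refine ⟨?_, ?_, ?_⟩ <;> linarith
  · have hA := four_set_cancelled_le f hmono hsubmod A B C D
    have hB := four_set_cancelled_le f hmono hsubmod B A C D
    have hC := four_set_cancelled_le f hmono hsubmod C A B D
    have hD := four_set_cancelled_le f hmono hsubmod D A B C
    simp only [Finset.union_comm, Finset.union_left_comm, le_min_iff] at *
    refine ⟨?_, ?_, ?_, ?_⟩ <;> linarith
end

section
/- There exists a normalized, monotone, non-negative submodular function f whose 3-set submodular mutual information is negative. Concretely, let Ω be a finite set with |Ω| ≥ 14, let f(X) = min(|X|, 10), and let A, B, C ⊆ Ω be pairwise disjoint sets with |A| = 4 and |B| = |C| = 5. Then I_f(A;B;C) = −4 < 0. -/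
/-- There is a normalized, monotone, non-negative submodular function with negative 3-set
submodular mutual information: on a ground set with at least 14 elements, `f(X) = min(|X|, 10)`
is normalized, monotone, non-negative and submodular, yet for pairwise disjoint `A, B, C`
with `|A| = 4`, `|B| = |C| = 5`, one has `I_f(A;B;C) = −4 < 0`. -/
theorem truncated_cardinality_negative_three_set_mutual_information
    {Ω : Type*} [DecidableEq Ω] [Fintype Ω]
    (hcard : 14 ≤ Fintype.card Ω)
    (f : Finset Ω → ℝ)
    (hf : ∀ X : Finset Ω, f X = min (X.card : ℝ) 10)
    (A B C : Finset Ω)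
    (hAB : Disjoint A B) (hAC : Disjoint A C) (hBC : Disjoint B C)
    (hA : A.card = 4) (hB : B.card = 5) (hC : C.card = 5) :
    (f ∅ = 0) ∧
    (∀ X Y : Finset Ω, X ⊆ Y → f X ≤ f Y) ∧
    (∀ X : Finset Ω, 0 ≤ f X) ∧
    (∀ X Y : Finset Ω, f (X ∪ Y) + f (X ∩ Y) ≤ f X + f Y) ∧
    (f A + f B + f C - f (A ∪ B) - f (B ∪ C) - f (A ∪ C) + f (A ∪ B ∪ C) = -4) ∧
    (f A + f B + f C - f (A ∪ B) - f (B ∪ C) - f (A ∪ C) + f (A ∪ B ∪ C) < 0) := by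
  have hI : f A + f B + f C - f (A ∪ B) - f (B ∪ C) - f (A ∪ C) + f (A ∪ B ∪ C) = -4 := by
    have hABC : Disjoint (A ∪ B) C := Finset.disjoint_union_left.2 ⟨hAC, hBC⟩
    simp only [hf, Finset.card_union_of_disjoint hABC, Finset.card_union_of_disjoint hAB,
      Finset.card_union_of_disjoint hAC, Finset.card_union_of_disjoint hBC, hA, hB, hC]
    norm_num
  refine ⟨by simp [hf], fun X Y h => ?_, fun X => ?_, fun X Y => ?_, hI, by rw [hI]; norm_num⟩
  · rw [hf, hf]
    exact min_le_min_right _ (by exact_mod_cast Finset.card_le_card h)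
  · rw [hf]
    positivity
  · have hcard_add := Finset.card_union_add_card_inter X Y
    have hX := Finset.card_le_card (Finset.subset_union_left (s₁ := X) (s₂ := Y))
    have hY := Finset.card_le_card (Finset.subset_union_right (s₁ := X) (s₂ := Y))
    simp only [hf]
    norm_cast
    omega
end

section
/- Let f be a monotone submodular set function on a finite ground set Ω. Then the submodular variation of information D_f(A,B) = 2 f(A∪B) − f(A) − f(B) is a pseudometric on subsets of Ω: for all A, B, C ⊆ Ω, (i) D_f(A,B) ≥ 0, (ii) D_f(A,B) = D_f(B,A), (iii) D_f(A,A) = 0, and (iv) the triangle inequality D_f(A,C) ≤ D_f(A,B) + D_f(B,C) holds. -/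
/-- For a monotone submodular `f`, the submodular variation of information
`D_f(A,B) = 2 f(A∪B) − f(A) − f(B)` is a pseudometric: non-negative, symmetric,
zero on the diagonal, and satisfies the triangle inequality. -/
theorem variation_of_information_pseudometric
    {Ω : Type*} [DecidableEq Ω] [Fintype Ω] (f : Finset Ω → ℝ)
    (hmono : ∀ X Y : Finset Ω, X ⊆ Y → f X ≤ f Y)
    (hsubmod : ∀ X Y : Finset Ω, f (X ∪ Y) + f (X ∩ Y) ≤ f X + f Y) :
    ∀ A B C : Finset Ω,
      (0 ≤ 2 * f (A ∪ B) - f A - f B) ∧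
      (2 * f (A ∪ B) - f A - f B = 2 * f (B ∪ A) - f B - f A) ∧
      (2 * f (A ∪ A) - f A - f A = 0) ∧
      (2 * f (A ∪ C) - f A - f C
        ≤ (2 * f (A ∪ B) - f A - f B) + (2 * f (B ∪ C) - f B - f C)) := by
  intro A B C
  have hA := hmono A (A ∪ B) Finset.subset_union_left
  have hB := hmono B (A ∪ B) Finset.subset_union_right
  have hsub := hsubmod (A ∪ B) (B ∪ C)
  have hunion := hmono (A ∪ C) ((A ∪ B) ∪ (B ∪ C))
    (Finset.union_subset_union Finset.subset_union_left Finset.subset_union_right)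
  have hinter := hmono B ((A ∪ B) ∩ (B ∪ C))
    (Finset.subset_inter Finset.subset_union_right Finset.subset_union_left)
  refine ⟨by linarith, ?_, ?_, by linarith⟩
  · rw [Finset.union_comm B A]
    ring
  · rw [Finset.union_self]
    ring
end

section
/- Let f be a monotone submodular set function on a finite ground set Ω such that f({j} | Ω∖{j}) > 0 for every j ∈ Ω. Then the submodular variation of information D_f satisfies the identity of indiscernibles: for all A, B ⊆ Ω, D_f(A,B) = 0 implies A = B. (In particular, D_f is then a metric on subsets of Ω.) -/
/-- A monotone submodular function all of whose top marginal gains are positive is strictly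
monotone. -/
theorem strictMono_of_submodular_of_pos_gain
    {Ω : Type*} [DecidableEq Ω] [Fintype Ω] {f : Finset Ω → ℝ}
    (hmono : ∀ X Y : Finset Ω, X ⊆ Y → f X ≤ f Y)
    (hsubmod : ∀ X Y : Finset Ω, f (X ∪ Y) + f (X ∩ Y) ≤ f X + f Y)
    (hpos : ∀ j : Ω, 0 < f ({j} ∪ (Finset.univ \ {j})) - f (Finset.univ \ {j})) :
    StrictMono f := by
  intro X Y hXY
  have hsub : X ⊆ Y := hXY.le
  obtain ⟨j, hjY, hjX⟩ := Finset.exists_of_ssubset hXY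
  have hunion : Y ∪ (Finset.univ \ {j}) = {j} ∪ (Finset.univ \ {j}) := by
    ext x
    by_cases hx : x = j <;> simp [hx, hjY]
  have hle : f X ≤ f (Y ∩ (Finset.univ \ {j})) := by
    refine hmono _ _ fun x hx => ?_
    have hxj : x ≠ j := fun h => hjX (h ▸ hx)
    simp [hsub hx, hxj]
  have hgain := hsubmod Y (Finset.univ \ {j})
  rw [hunion] at hgain
  linarith [hpos j]


/-- For a monotone submodular `f` with `f({j} | Ω∖{j}) > 0` for every `j`, the submodular
variation of information satisfies the identity of indiscernibles:
`D_f(A,B) = 0` implies `A = B`. -/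
theorem variation_of_information_identity_of_indiscernibles
    {Ω : Type*} [DecidableEq Ω] [Fintype Ω] (f : Finset Ω → ℝ)
    (hmono : ∀ X Y : Finset Ω, X ⊆ Y → f X ≤ f Y)
    (hsubmod : ∀ X Y : Finset Ω, f (X ∪ Y) + f (X ∩ Y) ≤ f X + f Y)
    (hpos : ∀ j : Ω, 0 < f ({j} ∪ (Finset.univ \ {j})) - f (Finset.univ \ {j})) :
    ∀ A B : Finset Ω, 2 * f (A ∪ B) - f A - f B = 0 → A = B := by
  intro A B h
  have hstrict := strictMono_of_submodular_of_pos_gain hmono hsubmod hpos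
  have hA := hmono A (A ∪ B) Finset.subset_union_left
  have hB := hmono B (A ∪ B) Finset.subset_union_right
  have eq_of_le : ∀ {X Y : Finset Ω}, X ⊆ Y → f Y ≤ f X → X = Y := fun hXY hle =>
    eq_of_le_of_not_lt hXY fun hlt => (hstrict hlt).not_ge hle
  have hAU := eq_of_le (Finset.subset_union_left : A ⊆ A ∪ B) (by linarith)
  have hBU := eq_of_le (Finset.subset_union_right : B ⊆ A ∪ B) (by linarith)
  exact hAU.trans hBU.symm
end

section
/- Let U be a finite set of concepts, γ : Ω → 2^U a covering map extended to sets by γ(A) = ∪_{a∈A} γ(a), w : U → ℝ a weight function with w(S) = Σ_{u∈S} w(u), and let f(A) = w(γ(A)) be the weighted set cover function. Then for all A, B, A_1,…,A_k ⊆ Ω: (i) I_f(A;B) = w(γ(A) ∩ γ(B)); (ii) f(A|B) = w(γ(A) ∖ γ(B)); (iii) D_f(A,B) = w(γ(A) △ γ(B)); and (iv) the k-set submodular mutual information satisfies I_f(A_1;…;A_k) = w(γ(A_1) ∩ ⋯ ∩ γ(A_k)). -/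
open Finset in
/-- **Inclusion-exclusion principle**: the sum of a function over a nonempty finite intersection
in terms of its sums over the unions. -/
theorem sum_inf_eq_neg_sum_powerset_sum_sup {ι U R : Type*} [DecidableEq U] [Fintype U]
    [Ring R] {s : Finset ι} (hs : s.Nonempty) (S : ι → Finset U) (w : U → R) :
    ∑ u ∈ s.inf S, w u = -∑ T ∈ s.powerset, (-1 : R) ^ #T * ∑ u ∈ T.sup S, w u := by
  have h := inclusion_exclusion_sum_inf_compl s (fun i => (S i)ᶜ) w
  simp only [compl_compl] at h
  have alternating : ∑ T ∈ s.powerset, (-1 : R) ^ #T = 0 := by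
    exact_mod_cast congrArg (Int.cast : ℤ → R) (sum_powerset_neg_one_pow_card_of_nonempty hs)
  have hcompl (T : Finset ι) :
      ∑ u ∈ T.inf fun i => (S i)ᶜ, w u = ∑ u, w u - ∑ u ∈ T.sup S, w u := by
    rw [← Finset.compl_sup, eq_sub_iff_add_eq, sum_compl_add_sum]
  rw [h]
  simp only [hcompl, zsmul_eq_mul, Int.cast_pow, Int.cast_neg, Int.cast_one, mul_sub,
    sum_sub_distrib, ← sum_mul, alternating, zero_mul, zero_sub]


/-- For the weighted set cover function `f(A) = w(γ(A))` with `γ(A) = ∪_{a∈A} γ(a)`: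
(i) `I_f(A;B) = w(γ(A) ∩ γ(B))`; (ii) `f(A|B) = w(γ(A) ∖ γ(B))`;
(iii) `D_f(A,B) = w(γ(A) △ γ(B))`;
(iv) the k-set submodular mutual information is `w(γ(A_1) ∩ ⋯ ∩ γ(A_k))`. -/
theorem weighted_set_cover_information_measures
    {Ω U : Type*} [DecidableEq Ω] [Fintype Ω] [DecidableEq U] [Fintype U]
    (γ : Ω → Finset U) (w : U → ℝ) (f : Finset Ω → ℝ)
    (hf : ∀ A : Finset Ω, f A = ∑ u ∈ A.sup γ, w u) :
    (∀ A B : Finset Ω, f A + f B - f (A ∪ B) = ∑ u ∈ A.sup γ ∩ B.sup γ, w u) ∧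
    (∀ A B : Finset Ω, f (A ∪ B) - f B = ∑ u ∈ A.sup γ \ B.sup γ, w u) ∧
    (∀ A B : Finset Ω,
      2 * f (A ∪ B) - f A - f B = ∑ u ∈ (A.sup γ \ B.sup γ) ∪ (B.sup γ \ A.sup γ), w u) ∧
    (∀ (k : ℕ) (A : Fin (k + 1) → Finset Ω),
      -(∑ T ∈ Finset.univ.powerset.filter (fun T : Finset (Fin (k + 1)) => T.Nonempty),
          (-1 : ℝ) ^ T.card * f (T.sup A))
        = ∑ u ∈ Finset.univ.inf' Finset.univ_nonempty (fun i => (A i).sup γ), w u) := by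
  have union_add_inter (A B : Finset Ω) :
      f (A ∪ B) + ∑ u ∈ A.sup γ ∩ B.sup γ, w u = f A + f B := by
    simpa only [hf, Finset.sup_union, Finset.sup_eq_union] using Finset.sum_union_inter
  have gain (A B : Finset Ω) : f (A ∪ B) - f B = ∑ u ∈ A.sup γ \ B.sup γ, w u := by
    rw [hf, hf, Finset.sup_union, Finset.sup_eq_union, ← Finset.sdiff_union_self_eq_union,
      Finset.sum_union Finset.sdiff_disjoint, add_sub_cancel_right]
  refine ⟨fun A B => by linarith [union_add_inter A B], gain, fun A B => ?_, fun k A => ?_⟩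
  · rw [Finset.sum_union disjoint_sdiff_sdiff, ← gain, ← gain, Finset.union_comm B A]
    ring
  · have sup_sup (T : Finset (Fin (k + 1))) : (T.sup A).sup γ = T.sup fun i => (A i).sup γ := by
      rw [Finset.sup_eq_biUnion T A, Finset.sup_biUnion]
    rw [Finset.inf'_eq_inf, sum_inf_eq_neg_sum_powerset_sum_sup Finset.univ_nonempty,
      Finset.sum_filter_of_ne]
    · simp only [hf, sup_sup]
    · intro T _ hT
      contrapose! hT
      simp [hT, hf]
end

section
/- Let U be a finite set of concepts, p : U × Ω → [0,1] coverage probabilities, w : U → ℝ weights, P_i(A) = Π_{a∈A} (1 − p_{ia}), and let f(A) = Σ_{i∈U} w_i (1 − P_i(A)) be the probabilistic set cover function. Then for all A, B ⊆ Ω: (i) I_f(A;B) = Σ_{i∈U} w_i (1 − (P_i(A) + P_i(B) − P_i(A∪B))); (ii) if A and B are disjoint, I_f(A;B) = Σ_{i∈U} w_i (1 − P_i(A))(1 − P_i(B)); (iii) f(A|B) = Σ_{i∈U} w_i P_i(B)(1 − P_i(A∖B)); and (iv) D_f(A,B) = Σ_{i∈U} w_i [P_i(B)(1 − P_i(A∖B))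 + P_i(A)(1 − P_i(B∖A))]. -/
/-- For the probabilistic set cover function `f(A) = Σ_i w_i (1 − P_i(A))` with
`P_i(A) = Π_{a∈A} (1 − p_{ia})`:
(i) `I_f(A;B) = Σ_i w_i (1 − (P_i(A) + P_i(B) − P_i(A∪B)))`;
(ii) if `A` and `B` are disjoint, `I_f(A;B) = Σ_i w_i (1 − P_i(A))(1 − P_i(B))`;
(iii) `f(A|B) = Σ_i w_i P_i(B)(1 − P_i(A∖B))`;
(iv) `D_f(A,B) = Σ_i w_i [P_i(B)(1 − P_i(A∖B)) + P_i(A)(1 − P_i(B∖A))]`. -/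
theorem probabilistic_set_cover_information_measures
    {Ω U : Type*} [DecidableEq Ω] [Fintype Ω] [Fintype U]
    (p : U → Ω → ℝ) (hp : ∀ i a, 0 ≤ p i a ∧ p i a ≤ 1)
    (w : U → ℝ) (f : Finset Ω → ℝ)
    (hf : ∀ A : Finset Ω, f A = ∑ i : U, w i * (1 - ∏ a ∈ A, (1 - p i a))) :
    ∀ A B : Finset Ω,
      let P : U → Finset Ω → ℝ := fun i X => ∏ a ∈ X, (1 - p i a)
      (f A + f B - f (A ∪ B)
        = ∑ i : U, w i * (1 - (P i A + P i B - P i (A ∪ B)))) ∧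
      (Disjoint A B →
        f A + f B - f (A ∪ B) = ∑ i : U, w i * ((1 - P i A) * (1 - P i B))) ∧
      (f (A ∪ B) - f B = ∑ i : U, w i * (P i B * (1 - P i (A \ B)))) ∧
      (2 * f (A ∪ B) - f A - f B
        = ∑ i : U, w i * (P i B * (1 - P i (A \ B)) + P i A * (1 - P i (B \ A)))) := by
  intro A B P
  have hf' (X : Finset Ω) : f X = ∑ i : U, w i * (1 - P i X) := hf X
  have union_left (i : U) : P i (A ∪ B) = P i (A \ B) * P i B := by
    simp only [P]
    rw [← Finset.prod_union Finset.sdiff_disjoint, Finset.sdiff_union_self_eq_union]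
  have union_right (i : U) : P i (A ∪ B) = P i (B \ A) * P i A := by
    simp only [P]
    rw [← Finset.prod_union Finset.sdiff_disjoint, Finset.sdiff_union_self_eq_union,
      Finset.union_comm]
  simp only [hf', Finset.mul_sum, ← Finset.sum_add_distrib, ← Finset.sum_sub_distrib]
  refine ⟨?_, fun hAB => ?_, ?_, ?_⟩ <;> refine Finset.sum_congr rfl fun i _ => ?_
  · ring
  · have union_disjoint : P i (A ∪ B) = P i A * P i B := Finset.prod_union hAB
    rw [union_disjoint]
    ring
  · rw [union_left]
    ring
  · linear_combination -w i * union_left i - w i * union_right i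
end

section
/- Let s : Ω × Ω → ℝ be a similarity kernel and let f(A) = Σ_{i∈Ω} max_{a∈A} s(i,a) be the facility location function (defined for nonempty A). Then for all nonempty A, B, A_1,…,A_k ⊆ Ω: (i) I_f(A;B) = Σ_{i∈Ω} min(max_{a∈A} s(i,a), max_{b∈B} s(i,b)); (ii) f(A|B) = Σ_{i∈Ω} max(0, max_{a∈A} s(i,a) − max_{b∈B} s(i,b)); (iii) D_f(A,B) = Σ_{i∈Ω} |max_{a∈A} s(i,a) − max_{b∈B} s(i,b)|; and (iv) the k-set submodular mutual information satisfies I_f(A_1;…;A_k) = Σ_{i∈Ω} min(max_{a∈A_1} s(i,a), …, max_{a∈A_k} s(i,a)). -/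
/-- The maximum of a real function over a finset, with value `0` on the empty set. -/
noncomputable def maxOrZero {ι : Type*} (x : ι → ℝ) (T : Finset ι) : ℝ :=
  if h : T.Nonempty then T.sup' h x else 0

/-- The maximum-minimums identity, for a minimizer `m` of `x` on `S`. -/
theorem sum_powerset_neg_one_pow_mul_maxOrZero {ι : Type*} [DecidableEq ι] (x : ι → ℝ)
    (S : Finset ι) (m : ι) (hm : m ∈ S) (hmin : ∀ j ∈ S, x m ≤ x j) :
    ∑ T ∈ S.powerset, (-1 : ℝ) ^ T.card * maxOrZero x T = -x m := by
  rw [← Finset.insert_erase hm, Finset.sum_powerset_insert (Finset.notMem_erase m S),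
    ← Finset.sum_add_distrib, Finset.sum_eq_single ∅]
  · simp [maxOrZero]
  · intro T hT hne
    have hTS := Finset.mem_powerset.mp hT
    have hTn : T.Nonempty := Finset.nonempty_iff_ne_empty.mpr hne
    have hmT : m ∉ T := fun h => Finset.notMem_erase m S (hTS h)
    have hsup : x m ≤ T.sup' hTn x := by
      obtain ⟨j, hj⟩ := hTn
      exact (hmin j (Finset.mem_of_mem_erase (hTS hj))).trans (Finset.le_sup' x hj)
    have hins : maxOrZero x (insert m T) = maxOrZero x T := by
      rw [maxOrZero, maxOrZero, dif_pos (Finset.insert_nonempty m T), dif_pos hTn,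
        Finset.sup'_insert (H := hTn), sup_eq_right.mpr hsup]
    rw [hins, Finset.card_insert_of_notMem hmT]
    ring
  · intro h
    exact absurd (Finset.empty_mem_powerset _) h

theorem sup'_sup_eq_maxOrZero {ι α : Type*} [DecidableEq α] (g : α → ℝ) (A : ι → Finset α)
    (hA : ∀ t, (A t).Nonempty) (T : Finset ι) (hT : T.Nonempty) (h : (T.sup A).Nonempty) :
    (T.sup A).sup' h g = maxOrZero (fun t => (A t).sup' (hA t) g) T := by
  rw [maxOrZero, dif_pos hT]
  refine eq_of_forall_ge_iff fun c => ?_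
  simp only [Finset.sup'_le_iff, Finset.mem_sup]
  exact ⟨fun H t ht a ha => H a ⟨t, ht, ha⟩, fun H a ⟨t, ht, ha⟩ => H t ht a ha⟩

/-- The maximum-minimums identity for maxima over unions. -/
theorem neg_sum_neg_one_pow_mul_sup'_sup {ι α : Type*} [DecidableEq ι] [Fintype ι] [Nonempty ι]
    [DecidableEq α] (g : α → ℝ) (A : ι → Finset α) (hA : ∀ t, (A t).Nonempty)
    (h : ∀ T : {T // T ∈ Finset.univ.powerset.filter (fun T : Finset ι => T.Nonempty)},
      (T.1.sup A).Nonempty) :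
    -(∑ T ∈ (Finset.univ.powerset.filter (fun T : Finset ι => T.Nonempty)).attach,
        (-1 : ℝ) ^ T.1.card * (T.1.sup A).sup' (h T) g)
      = Finset.univ.inf' Finset.univ_nonempty (fun t => (A t).sup' (hA t) g) := by
  set x : ι → ℝ := fun t => (A t).sup' (hA t) g with hx
  obtain ⟨m, hm, hmin⟩ := Finset.exists_mem_eq_inf' Finset.univ_nonempty x
  have key := sum_powerset_neg_one_pow_mul_maxOrZero x Finset.univ m hm
    fun j hj => hmin ▸ Finset.inf'_le x hj
  rw [hmin, neg_eq_iff_eq_neg, ← key]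
  calc _ = ∑ T ∈ (Finset.univ.powerset.filter (fun T : Finset ι => T.Nonempty)).attach,
        (-1 : ℝ) ^ T.1.card * maxOrZero x T.1 :=
        Finset.sum_congr rfl fun T _ => by
          rw [sup'_sup_eq_maxOrZero g A hA T.1 (Finset.mem_filter.mp T.2).2]
    _ = ∑ T ∈ Finset.univ.powerset.filter (fun T : Finset ι => T.Nonempty),
        (-1 : ℝ) ^ T.card * maxOrZero x T :=
        Finset.sum_attach _ fun T => (-1 : ℝ) ^ T.card * maxOrZero x T
    _ = _ := by
        refine Finset.sum_filter_of_ne fun T _ hne => ?_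
        by_contra hT
        exact hne (by rw [maxOrZero, dif_neg hT, mul_zero])


/-- For the facility location function `f(A) = Σ_{i∈Ω} max_{a∈A} s(i,a)` (on nonempty sets):
(i) `I_f(A;B) = Σ_i min(max_{a∈A} s(i,a), max_{b∈B} s(i,b))`;
(ii) `f(A|B) = Σ_i max(0, max_{a∈A} s(i,a) − max_{b∈B} s(i,b))`;
(iii) `D_f(A,B) = Σ_i |max_{a∈A} s(i,a) − max_{b∈B} s(i,b)|`;
(iv) the k-set submodular mutual information is `Σ_i min_t max_{a∈A_t} s(i,a)`. -/
theorem facility_location_information_measures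
    {Ω : Type*} [DecidableEq Ω] [Fintype Ω] (s : Ω → Ω → ℝ) :
    (∀ (A B : Finset Ω) (hA : A.Nonempty) (hB : B.Nonempty),
      (∑ i : Ω, A.sup' hA (s i)) + (∑ i : Ω, B.sup' hB (s i))
          - ∑ i : Ω, (A ∪ B).sup' (hA.mono Finset.subset_union_left) (s i)
        = ∑ i : Ω, min (A.sup' hA (s i)) (B.sup' hB (s i))) ∧
    (∀ (A B : Finset Ω) (hA : A.Nonempty) (hB : B.Nonempty),
      (∑ i : Ω, (A ∪ B).sup' (hA.mono Finset.subset_union_left) (s i))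
          - ∑ i : Ω, B.sup' hB (s i)
        = ∑ i : Ω, max 0 (A.sup' hA (s i) - B.sup' hB (s i))) ∧
    (∀ (A B : Finset Ω) (hA : A.Nonempty) (hB : B.Nonempty),
      2 * (∑ i : Ω, (A ∪ B).sup' (hA.mono Finset.subset_union_left) (s i))
          - (∑ i : Ω, A.sup' hA (s i)) - ∑ i : Ω, B.sup' hB (s i)
        = ∑ i : Ω, |A.sup' hA (s i) - B.sup' hB (s i)|) ∧
    (∀ (k : ℕ) (A : Fin (k + 1) → Finset Ω) (hA : ∀ t, (A t).Nonempty),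
      -(∑ T ∈ (Finset.univ.powerset.filter
            (fun T : Finset (Fin (k + 1)) => T.Nonempty)).attach,
          (-1 : ℝ) ^ T.1.card *
            ∑ i : Ω, (T.1.sup A).sup'
              (by
                obtain ⟨j, hj⟩ := (Finset.mem_filter.mp T.2).2
                exact (hA j).mono (Finset.le_sup hj)) (s i))
        = ∑ i : Ω, Finset.univ.inf' Finset.univ_nonempty
            (fun t => (A t).sup' (hA t) (s i))) := by
  refine ⟨fun A B hA hB => ?_, fun A B hA hB => ?_, fun A B hA hB => ?_, fun k A hA => ?_⟩
  · rw [← Finset.sum_add_distrib, ← Finset.sum_sub_distrib]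
    refine Finset.sum_congr rfl fun i _ => ?_
    rw [Finset.sup'_union hA hB]
    exact sub_eq_of_eq_add (min_add_max _ _).symm
  · rw [← Finset.sum_sub_distrib]
    refine Finset.sum_congr rfl fun i _ => ?_
    rw [Finset.sup'_union hA hB, max_comm, ← sub_self (B.sup' hB (s i)), max_sub_sub_right]
  · rw [Finset.mul_sum, ← Finset.sum_sub_distrib, ← Finset.sum_sub_distrib]
    refine Finset.sum_congr rfl fun i _ => ?_
    rw [Finset.sup'_union hA hB, abs_sub_comm, ← max_sub_min_eq_abs]
    linarith [min_add_max (A.sup' hA (s i)) (B.sup' hB (s i))]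
  · simp_rw [Finset.mul_sum]
    rw [Finset.sum_comm, ← Finset.sum_neg_distrib]
    exact Finset.sum_congr rfl fun i _ => neg_sum_neg_one_pow_mul_sup'_sup (s i) A hA _
end

section
/- Let s : Ω × Ω → ℝ be a symmetric similarity kernel, λ ∈ ℝ, and let f(A) = λ Σ_{i∈Ω} Σ_{a∈A} s(i,a) − Σ_{a_1∈A} Σ_{a_2∈A} s(a_1,a_2) be the generalized graph cut function. Then for all A, B ⊆ Ω: (i) if A and B are disjoint, I_f(A;B) = 2 Σ_{a∈A} Σ_{b∈B} s(a,b); and (ii) f(A|B) = f(A∖B) − 2 Σ_{a∈A∖B} Σ_{b∈B} s(a,b). -/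
/-- For the generalized graph cut function
`f(A) = λ Σ_{i∈Ω} Σ_{a∈A} s(i,a) − Σ_{a₁∈A} Σ_{a₂∈A} s(a₁,a₂)` with symmetric kernel `s`:
(i) if `A` and `B` are disjoint, `I_f(A;B) = 2 Σ_{a∈A} Σ_{b∈B} s(a,b)`;
(ii) `f(A|B) = f(A∖B) − 2 Σ_{a∈A∖B} Σ_{b∈B} s(a,b)`. -/
theorem generalized_graph_cut_information_measures
    {Ω : Type*} [DecidableEq Ω] [Fintype Ω] (s : Ω → Ω → ℝ)
    (hs : ∀ x y : Ω, s x y = s y x) (lam : ℝ) (f : Finset Ω → ℝ)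
    (hf : ∀ A : Finset Ω,
      f A = lam * (∑ i : Ω, ∑ a ∈ A, s i a) - ∑ a₁ ∈ A, ∑ a₂ ∈ A, s a₁ a₂) :
    ∀ A B : Finset Ω,
      (Disjoint A B → f A + f B - f (A ∪ B) = 2 * ∑ a ∈ A, ∑ b ∈ B, s a b) ∧
      (f (A ∪ B) - f B = f (A \ B) - 2 * ∑ a ∈ A \ B, ∑ b ∈ B, s a b) := by
  have key : ∀ A B : Finset Ω, Disjoint A B →
      f A + f B - f (A ∪ B) = 2 * ∑ a ∈ A, ∑ b ∈ B, s a b := by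
    intro A B hAB
    have hcross : ∑ b ∈ B, ∑ a ∈ A, s b a = ∑ a ∈ A, ∑ b ∈ B, s a b := by
      rw [Finset.sum_comm]
      exact Finset.sum_congr rfl fun a _ => Finset.sum_congr rfl fun b _ => hs b a
    rw [hf, hf, hf]
    simp only [Finset.sum_union hAB, Finset.sum_add_distrib, hcross]
    ring
  intro A B
  refine ⟨key A B, ?_⟩
  have h := key (A \ B) B Finset.sdiff_disjoint
  rw [Finset.sdiff_union_self_eq_union] at h
  linarith
end
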